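/- If (X, <_X) is a linear order, then (ϑ_X, <_{ϑ_X}) is a linear order. -/

import Mathlib

set_option linter.unusedSectionVars false
set_option linter.unusedVariables false

inductive ThetaTerm (X : Type) : Type where
  | zero : ThetaTerm X
  | Om : ThetaTerm X
  | E (x : X) : ThetaTerm X
  | th (s : ThetaTerm X) : ThetaTerm X
  | om (ss : List (ThetaTerm X)) : ThetaTerm X

variable {X : Type} [LinearOrder X]

mutual
def tsize : ThetaTerm X → ℕ
  | .zero => 1
  | .Om => 1
  | .E _ => 1
  | .th s => tsize s + 1
  | .om ss => tsizeL ss + 1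
def tsizeL : List (ThetaTerm X) → ℕ
  | [] => 0
  | s :: ss => tsize s + tsizeL ss + 1
end

theorem tsize_pos (t : ThetaTerm X) : 1 ≤ tsize t := by
  cases t <;> simp [tsize]

attribute [local instance] Classical.propDecidable

mutual
/-- The map `s ↦ s*` of the notation system `ϑ_X`, bundled with the (definitional) bound
`tsize s* ≤ tsize s`: `0* = Ω* = (𝔈_x)* = 0`, `(ϑ s)* = ϑ s`, and
`(ω^{s₀}+…+ω^{s_n})* = max_{i≤n} s_i*` (maximum with respect to `<_{ϑ_X}`). -/
noncomputable def thStar : (t : ThetaTerm X) → {u : ThetaTerm X // tsize u ≤ tsize t}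
  | .zero => ⟨.zero, le_rfl⟩
  | .Om => ⟨.zero, by simp [tsize]⟩
  | .E _ => ⟨.zero, by simp [tsize]⟩
  | .th s => ⟨.th s, le_rfl⟩
  | .om ss =>
    match thStarL ss with
    | ⟨u, hu⟩ => ⟨u, by simp only [tsize]; omega⟩

termination_by t => 3 * tsize t + 1
decreasing_by
  all_goals simp only [tsize, tsizeL] at *
  all_goals omega

/-- The maximum (with respect to `<_{ϑ_X}`) of the `*`-values of a list of terms. -/
noncomputable def thStarL : (ss : List (ThetaTerm X)) →
    {u : ThetaTerm X // tsize u ≤ max 1 (tsizeL ss)}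
  | [] => ⟨.zero, by simp [tsize, tsizeL]⟩
  | [s] =>
    match thStar s with
    | ⟨u, hu⟩ => ⟨u, by simp only [tsizeL]; omega⟩
  | s :: t :: ts =>
    match thStar s, thStarL (t :: ts) with
    | ⟨u, hu⟩, ⟨v, hv⟩ =>
      if thLt u v then ⟨v, by have := tsize_pos s; simp only [tsizeL] at *; omega⟩
      else ⟨u, by have := tsize_pos t; simp only [tsizeL] at *; omega⟩

termination_by ss => 3 * tsizeL ss + 2
decreasing_by
  all_goals simp only [tsize, tsizeL] at *
  all_goals omega

/-- The relation `<_{ϑ_X}` on (raw) terms, following the simultaneous recursive definition. -/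
noncomputable def thLt : ThetaTerm X → ThetaTerm X → Prop
  | _, .zero => False
  | .zero, _ => True
  | .Om, .Om => False
  | .Om, .E _ => True
  | .Om, .th _ => False
  | .Om, .om [] => False
  | .Om, .om (t₀ :: _) => thLt .Om t₀ ∨ ThetaTerm.Om = t₀
  | .E _, .Om => False
  | .E x, .E y => x < y
  | .E _, .th _ => False
  | .E _, .om [] => False
  | .E x, .om (t₀ :: _) => thLt (.E x) t₀ ∨ ThetaTerm.E x = t₀
  | .th _, .Om => True
  | .th _, .E _ => True
  | .th s', .th t' =>
      (match thStar s' with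
       | ⟨u, hu⟩ => thLt s' t' ∧ thLt u (.th t')) ∨
      (match thStar t' with
       | ⟨v, hv⟩ => thLt (.th s') v ∨ ThetaTerm.th s' = v)
  | .th _, .om [] => False
  | .th s', .om (t₀ :: _) => thLt (.th s') t₀ ∨ ThetaTerm.th s' = t₀
  | .om [], .Om => False
  | .om [], .E _ => False
  | .om [], .th _ => False
  | .om (s₀ :: _), .Om => thLt s₀ .Om
  | .om (s₀ :: _), .E y => thLt s₀ (.E y)
  | .om (s₀ :: _), .th t' => thLt s₀ (.th t')
  | .om ss, .om ts => thLexLt ss ts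

termination_by s t => 3 * (tsize s + tsize t)
decreasing_by
  all_goals simp only [tsize, tsizeL] at *
  all_goals omega

/-- Lexicographic comparison of ω-sums on their lists of exponents: a proper initial
segment is smaller, and otherwise the first difference decides. -/
noncomputable def thLexLt : List (ThetaTerm X) → List (ThetaTerm X) → Prop
  | [], [] => False
  | [], _ :: _ => True
  | _ :: _, [] => False
  | s :: ss, t :: ts => thLt s t ∨ (s = t ∧ thLexLt ss ts)
termination_by ss ts => 3 * (tsizeL ss + tsizeL ts) + 1
decreasing_by
  all_goals simp only [tsize, tsizeL] at *
  all_goals omega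
end

/-- Well-formed terms of the notation system `ϑ_X`: in an ω-sum with a single exponent the
exponent must not be of the form `Ω`, `𝔈_x` or `ϑ s`, and with several exponents they must be
weakly decreasing with respect to `<_{ϑ_X}`. -/
inductive ThetaWF : ThetaTerm X → Prop where
  | zero : ThetaWF .zero
  | Om : ThetaWF .Om
  | E (x : X) : ThetaWF (.E x)
  | th {s : ThetaTerm X} : ThetaWF s → ThetaWF (.th s)
  | om_single {s : ThetaTerm X} : ThetaWF s → s ≠ .Om → (∀ x : X, s ≠ .E x) →
      (∀ u : ThetaTerm X, s ≠ .th u) → ThetaWF (.om [s])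
  | om_many {ss : List (ThetaTerm X)} : 2 ≤ ss.length → (∀ s ∈ ss, ThetaWF s) →
      ss.Chain' (fun a b => thLt b a ∨ b = a) → ThetaWF (.om ss)

namespace ThetaTerm

/-- Terms other than `0` and the `ω`-sums, i.e. those denoting fixed points of `ω`-exponentiation. -/
inductive IsEps : ThetaTerm X → Prop where
  | Om : IsEps .Om
  | E (x : X) : IsEps (.E x)
  | th (s : ThetaTerm X) : IsEps (.th s)

theorem not_thLt_zero (s : ThetaTerm X) : ¬ thLt s .zero := by
  cases s <;> simp [thLt]

theorem zero_thLt {t : ThetaTerm X} (h : t ≠ .zero) : thLt .zero t := by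
  cases t <;> simp_all [thLt]

theorem ne_zero_of_thLt {s t : ThetaTerm X} (h : thLt s t) : t ≠ .zero := by
  rintro rfl
  exact not_thLt_zero s h

theorem IsEps.thLt_om_iff {e : ThetaTerm X} (he : IsEps e) (t : ThetaTerm X)
    (ts : List (ThetaTerm X)) : thLt e (.om (t :: ts)) ↔ thLt e t ∨ e = t := by
  cases he <;> simp [thLt]

theorem IsEps.om_thLt_iff {e : ThetaTerm X} (he : IsEps e) (s : ThetaTerm X)
    (ss : List (ThetaTerm X)) : thLt (.om (s :: ss)) e ↔ thLt s e := by
  cases he <;> simp [thLt]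

theorem om_thLt_om_iff (ss ts : List (ThetaTerm X)) :
    thLt (.om ss) (.om ts) ↔ thLexLt ss ts := by
  cases ss <;> simp [thLt]

theorem th_thLt_th_iff (s t : ThetaTerm X) :
    thLt (.th s) (.th t) ↔ (thLt s t ∧ thLt (thStar s).1 (.th t)) ∨
      (thLt (.th s) (thStar t).1 ∨ .th s = (thStar t).1) := by
  rw [thLt]

theorem thLexLt_cons_iff (s t : ThetaTerm X) (ss ts : List (ThetaTerm X)) :
    thLexLt (s :: ss) (t :: ts) ↔ thLt s t ∨ (s = t ∧ thLexLt ss ts) := by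
  rw [thLexLt]

theorem thLexLt_irrefl (ss : List (ThetaTerm X)) (h : ∀ s ∈ ss, ¬ thLt s s) :
    ¬ thLexLt ss ss := by
  induction ss with
  | nil => simp [thLexLt]
  | cons s ss ih =>
    rw [thLexLt_cons_iff]
    simp_all

theorem thLexLt_trichotomy (ss ts : List (ThetaTerm X))
    (h : ∀ s ∈ ss, ∀ t ∈ ts, thLt s t ∨ s = t ∨ thLt t s) :
    thLexLt ss ts ∨ ss = ts ∨ thLexLt ts ss := by
  induction ss generalizing ts with
  | nil => cases ts <;> simp [thLexLt]
  | cons s ss ih =>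
    cases ts with
    | nil => simp [thLexLt]
    | cons t ts =>
      have h₁ := h s (by simp) t (by simp)
      have h₂ := ih ts fun a ha b hb => h a (by simp [ha]) b (by simp [hb])
      simp only [thLexLt_cons_iff, List.cons.injEq]
      grind

theorem thLexLt_trans (ss ts us : List (ThetaTerm X))
    (h : ∀ s ∈ ss, ∀ t ∈ ts, ∀ u ∈ us, thLt s t → thLt t u → thLt s u)
    (hst : thLexLt ss ts) (htu : thLexLt ts us) : thLexLt ss us := by
  induction ss generalizing ts us with
  | nil => cases ts <;> cases us <;> simp_all [thLexLt]
  | cons s ss ih =>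
    cases ts with
    | nil => simp [thLexLt] at hst
    | cons t ts =>
      cases us with
      | nil => simp [thLexLt] at htu
      | cons u us =>
        have h₁ := h s (by simp) t (by simp) u (by simp)
        have h₂ := ih ts us fun a ha b hb c hc =>
          h a (by simp [ha]) b (by simp [hb]) c (by simp [hc])
        simp only [thLexLt_cons_iff] at *
        grind

theorem tsize_lt_tsizeL {s : ThetaTerm X} {ss : List (ThetaTerm X)} (h : s ∈ ss) :
    tsize s < tsizeL ss := by
  induction ss with
  | nil => simp at h
  | cons t ts ih =>
    simp only [tsizeL]
    rcases List.mem_cons.1 h with rfl | h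
    · omega
    · have := ih h
      omega

theorem tsize_lt_tsize_om {s : ThetaTerm X} {ss : List (ThetaTerm X)} (h : s ∈ ss) :
    tsize s < tsize (.om ss) := by
  have := tsize_lt_tsizeL h
  simp only [tsize]
  omega

theorem tsize_thStar_lt (s : ThetaTerm X) : tsize (thStar s).1 < tsize (.th s) := by
  have := (thStar s).2
  simp only [tsize]
  omega

theorem forall_mem_wf {ss : List (ThetaTerm X)} (h : ThetaWF (.om ss)) :
    ∀ s ∈ ss, ThetaWF s := by
  cases h with
  | om_single h => simpa using h
  | om_many _ h _ => exact h

theorem ne_nil_of_wf {ss : List (ThetaTerm X)} (h : ThetaWF (.om ss)) : ss ≠ [] := by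
  cases h with
  | om_single h => simp
  | om_many h _ _ => rintro rfl; simp at h

theorem wf_of_th {s : ThetaTerm X} (h : ThetaWF (.th s)) : ThetaWF s := by
  cases h
  assumption

theorem thStar_om (ss : List (ThetaTerm X)) : (thStar (.om ss)).1 = (thStarL ss).1 := by
  rw [thStar]

theorem thStarL_mem (ss : List (ThetaTerm X)) :
    (thStarL ss).1 = .zero ∨ ∃ s ∈ ss, (thStarL ss).1 = (thStar s).1 := by
  induction ss with
  | nil => simp [thStarL]
  | cons s ss ih =>
    cases ss with
    | nil => exact .inr ⟨s, by simp, by rw [thStarL]⟩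
    | cons t ts =>
      have : (thStarL (s :: t :: ts)).1 = (thStarL (t :: ts)).1 ∨
          (thStarL (s :: t :: ts)).1 = (thStar s).1 := by
        rw [thStarL]
        by_cases h : thLt (thStar s).1 (thStarL (t :: ts)).1 <;> simp [h]
      grind

theorem thStar_eq (s : ThetaTerm X) (hs : ThetaWF s) :
    (thStar s).1 = .zero ∨ ∃ r, ThetaWF r ∧ (thStar s).1 = .th r := by
  match s, hs with
  | .zero, _ => simp [thStar]
  | .Om, _ => simp [thStar]
  | .E x, _ => simp [thStar]
  | .th r, hs => exact .inr ⟨r, wf_of_th hs, by simp [thStar]⟩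
  | .om ss, hs =>
    rw [thStar_om]
    rcases thStarL_mem ss with h | ⟨r, hr, h⟩
    · exact .inl h
    · have := tsize_lt_tsize_om hr
      rw [h]
      exact thStar_eq r (forall_mem_wf hs r hr)
termination_by tsize s

theorem wf_thStar {s : ThetaTerm X} (hs : ThetaWF s) : ThetaWF (thStar s).1 := by
  rcases thStar_eq s hs with h | ⟨r, hr, h⟩
  · rw [h]; exact .zero
  · rw [h]; exact .th hr

theorem thStar_thLt_th {s : ThetaTerm X} (hs : ThetaWF s) : thLt (thStar s).1 (.th s) := by
  rcases thStar_eq s hs with h | ⟨r, hr, h⟩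
  · rw [h]; exact zero_thLt (by simp)
  · rw [h, th_thLt_th_iff, h]
    simp

/-- Case distinction on well-formed terms. -/
theorem wf_cases {s : ThetaTerm X} (hs : ThetaWF s) :
    s = .zero ∨ IsEps s ∨ ∃ s₀ ss, s = .om (s₀ :: ss) ∧ ThetaWF s₀ := by
  cases s with
  | zero => exact .inl rfl
  | Om => exact .inr (.inl .Om)
  | E x => exact .inr (.inl (.E x))
  | th r => exact .inr (.inl (.th r))
  | om ss =>
    cases ss with
    | nil => exact absurd rfl (ne_nil_of_wf hs)
    | cons s₀ ss => exact .inr (.inr ⟨s₀, ss, rfl, forall_mem_wf hs s₀ (by simp)⟩)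

theorem tsize_head_lt (s : ThetaTerm X) (ss : List (ThetaTerm X)) :
    tsize s < tsize (.om (s :: ss)) :=
  tsize_lt_tsize_om (by simp)

theorem thLt_trichotomy (s t : ThetaTerm X) (hs : ThetaWF s) (ht : ThetaWF t) :
    thLt s t ∨ s = t ∨ thLt t s := by
  induction hn : tsize s + tsize t using Nat.strong_induction_on generalizing s t with
  | _ n ih =>
  have ih' : ∀ a b : ThetaTerm X, tsize a + tsize b < tsize s + tsize t → ThetaWF a → ThetaWF b →
      thLt a b ∨ a = b ∨ thLt b a := fun a b h ha hb => ih _ (hn ▸ h) a b ha hb rfl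
  clear ih hn
  rcases wf_cases hs with rfl | es | ⟨s₀, ss, rfl, hs₀⟩
  · by_cases h : t = .zero
    · exact .inr (.inl h.symm)
    · exact .inl (zero_thLt h)
  · rcases wf_cases ht with rfl | et | ⟨t₀, ts, rfl, ht₀⟩
    · cases es <;> simp [thLt]
    · cases es with
      | Om => cases et <;> simp [thLt]
      | E x =>
        cases et with
        | E y => simpa [thLt] using lt_trichotomy x y
        | _ => simp [thLt]
      | th r =>
        cases et with
        | th q =>
          have hr := wf_of_th hs
          have hq := wf_of_th ht
          have sr := tsize_thStar_lt r
          have sq := tsize_thStar_lt q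
          have h₁ := ih' r q (by simp only [tsize]; omega) hr hq
          have h₂ := ih' _ (.th q) (by omega) (wf_thStar hr) ht
          have h₃ := ih' (.th r) _ (by omega) hs (wf_thStar hq)
          rw [th_thLt_th_iff, th_thLt_th_iff]
          grind
        | _ => simp [thLt]
    · have := tsize_head_lt t₀ ts
      have h := ih' s t₀ (by omega) hs ht₀
      rw [es.thLt_om_iff, es.om_thLt_iff]
      tauto
  · rcases wf_cases ht with rfl | et | ⟨t₀, ts, rfl, ht₀⟩
    · exact .inr (.inr (zero_thLt (by simp)))
    · have := tsize_head_lt s₀ ss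
      have h := ih' s₀ t (by omega) hs₀ ht
      rw [et.thLt_om_iff, et.om_thLt_iff]
      grind
    · rw [om_thLt_om_iff, om_thLt_om_iff, om.injEq]
      refine thLexLt_trichotomy _ _ fun a ha b hb => ih' a b ?_ (forall_mem_wf hs a ha)
        (forall_mem_wf ht b hb)
      have := tsize_lt_tsize_om ha
      have := tsize_lt_tsize_om hb
      omega

theorem IsEps.thLt_trans {s t u : ThetaTerm X} (es : IsEps s) (et : IsEps t) (eu : IsEps u)
    (hs : ThetaWF s) (ht : ThetaWF t) (hu : ThetaWF u)
    (ih : ∀ a b c : ThetaTerm X, tsize a + tsize b + tsize c < tsize s + tsize t + tsize u →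
      ThetaWF a → ThetaWF b → ThetaWF c → thLt a b → thLt b c → thLt a c)
    (hst : thLt s t) (htu : thLt t u) : thLt s u := by
  cases es with
  | Om => cases et <;> cases eu <;> simp_all [thLt]
  | E x =>
    cases et with
    | E y =>
      cases eu with
      | E z =>
        simp only [thLt] at *
        exact hst.trans htu
      | _ => simp [thLt] at htu
    | _ => simp [thLt] at hst
  | th r =>
    cases eu with
    | Om => simp [thLt]
    | E z => simp [thLt]
    | th p =>
      cases et with
      | Om => simp [thLt] at htu
      | E y => simp [thLt] at htu
      | th q =>
        have hr := wf_of_th hs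
        have hq := wf_of_th ht
        have hp := wf_of_th hu
        have sr := tsize_thStar_lt r
        have sq := tsize_thStar_lt q
        have sp := tsize_thStar_lt p
        have h₁ := ih r q p (by simp only [tsize]; omega) hr hq hp
        have h₂ := ih _ (.th q) (.th p) (by omega) (wf_thStar hr) ht hu
        have h₃ := ih (.th r) _ (.th p) (by omega) hs (wf_thStar hq) hu
        have h₄ := ih (.th r) (.th q) _ (by omega) hs ht (wf_thStar hp)
        have hst' := (th_thLt_th_iff r q).1 hst
        have htu' := (th_thLt_th_iff q p).1 htu
        rcases htu' with ⟨hqp, hq'⟩ | hqp | hqp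
        · rcases hst' with ⟨hrq, hr'⟩ | hrq | hrq
          · exact (th_thLt_th_iff r p).2 (.inl ⟨h₁ hrq hqp, h₂ hr' htu⟩)
          · exact h₃ hrq hq'
          · rwa [hrq]
        · exact (th_thLt_th_iff r p).2 (.inr (.inl (h₄ hst hqp)))
        · exact (th_thLt_th_iff r p).2 (.inr (.inl (hqp ▸ hst)))

theorem thLt_trans (s t u : ThetaTerm X) (hs : ThetaWF s) (ht : ThetaWF t) (hu : ThetaWF u)
    (hst : thLt s t) (htu : thLt t u) : thLt s u := by
  induction hn : tsize s + tsize t + tsize u using Nat.strong_induction_on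
    generalizing s t u with
  | _ n ih =>
  have ih' : ∀ a b c : ThetaTerm X, tsize a + tsize b + tsize c < tsize s + tsize t + tsize u →
      ThetaWF a → ThetaWF b → ThetaWF c → thLt a b → thLt b c → thLt a c :=
    fun a b c h ha hb hc hab hbc => ih _ (hn ▸ h) a b c ha hb hc hab hbc rfl
  clear ih hn
  rcases wf_cases hu with rfl | eu | ⟨u₀, us, rfl, hu₀⟩
  · exact absurd htu (not_thLt_zero t)
  · rcases wf_cases ht with rfl | et | ⟨t₀, ts, rfl, ht₀⟩
    · exact absurd hst (not_thLt_zero s)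
    · rcases wf_cases hs with rfl | es | ⟨s₀, ss, rfl, hs₀⟩
      · exact zero_thLt (ne_zero_of_thLt htu)
      · exact es.thLt_trans et eu hs ht hu ih' hst htu
      · have := tsize_head_lt s₀ ss
        rw [et.om_thLt_iff] at hst
        rw [eu.om_thLt_iff]
        exact ih' s₀ t u (by omega) hs₀ ht hu hst htu
    · have := tsize_head_lt t₀ ts
      rw [eu.om_thLt_iff] at htu
      rcases wf_cases hs with rfl | es | ⟨s₀, ss, rfl, hs₀⟩
      · exact zero_thLt (ne_zero_of_thLt htu)
      · rw [es.thLt_om_iff] at hst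
        rcases hst with hst | rfl
        · exact ih' s t₀ u (by omega) hs ht₀ hu hst htu
        · exact htu
      · have := tsize_head_lt s₀ ss
        rw [om_thLt_om_iff, thLexLt_cons_iff] at hst
        rw [eu.om_thLt_iff]
        rcases hst with hst | ⟨rfl, -⟩
        · exact ih' s₀ t₀ u (by omega) hs₀ ht₀ hu hst htu
        · exact htu
  · have := tsize_head_lt u₀ us
    rcases wf_cases ht with rfl | et | ⟨t₀, ts, rfl, ht₀⟩
    · exact absurd hst (not_thLt_zero s)
    · rw [et.thLt_om_iff] at htu
      rcases wf_cases hs with rfl | es | ⟨s₀, ss, rfl, hs₀⟩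
      · exact zero_thLt (by simp)
      · rw [es.thLt_om_iff]
        rcases htu with htu | rfl
        · exact .inl (ih' s t u₀ (by omega) hs ht hu₀ hst htu)
        · exact .inl hst
      · have := tsize_head_lt s₀ ss
        rw [et.om_thLt_iff] at hst
        rw [om_thLt_om_iff, thLexLt_cons_iff]
        rcases htu with htu | rfl
        · exact .inl (ih' s₀ t u₀ (by omega) hs₀ ht hu₀ hst htu)
        · exact .inl hst
    · have := tsize_head_lt t₀ ts
      rcases wf_cases hs with rfl | es | ⟨s₀, ss, rfl, hs₀⟩
      · exact zero_thLt (by simp)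
      · rw [om_thLt_om_iff, thLexLt_cons_iff] at htu
        rw [es.thLt_om_iff] at *
        rcases htu with htu | ⟨rfl, -⟩
        · rcases hst with hst | rfl
          · exact .inl (ih' s t₀ u₀ (by omega) hs ht₀ hu₀ hst htu)
          · exact .inl htu
        · exact hst
      · rw [om_thLt_om_iff] at *
        refine thLexLt_trans _ _ _ (fun a ha b hb c hc => ih' a b c ?_ (forall_mem_wf hs a ha)
          (forall_mem_wf ht b hb) (forall_mem_wf hu c hc)) hst htu
        have := tsize_lt_tsize_om ha
        have := tsize_lt_tsize_om hb
        have := tsize_lt_tsize_om hc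
        omega

theorem thLt_irrefl (s : ThetaTerm X) (hs : ThetaWF s) : ¬ thLt s s := by
  induction hn : tsize s using Nat.strong_induction_on generalizing s with
  | _ n ih =>
  subst hn
  cases s with
  | zero => exact not_thLt_zero _
  | Om => simp [thLt]
  | E x => simp [thLt]
  | th r =>
    have hr := wf_of_th hs
    have sr := tsize_thStar_lt r
    rw [th_thLt_th_iff]
    rintro (⟨h, -⟩ | h | h)
    · exact ih _ (by simp only [tsize]; omega) r hr rfl h
    · exact ih _ sr _ (wf_thStar hr) rfl
        (thLt_trans _ _ _ (wf_thStar hr) hs (wf_thStar hr) (thStar_thLt_th hr) h)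
    · rw [← h] at sr
      exact lt_irrefl _ sr
  | om ss =>
    rw [om_thLt_om_iff]
    exact thLexLt_irrefl ss fun a ha => ih _ (tsize_lt_tsize_om ha) a (forall_mem_wf hs a ha) rfl

end ThetaTerm

/-- If `(X, <_X)` is a linear order, then `(ϑ_X, <_{ϑ_X})` is a linear order:
on well-formed terms the relation `<_{ϑ_X}` is irreflexive, transitive, and any two distinct
terms are comparable. -/
theorem thetaX_linearOrder (X : Type) [LinearOrder X] :
    (∀ s : {t : ThetaTerm X // ThetaWF t}, ¬ thLt s.val s.val) ∧
    (∀ s t u : {t : ThetaTerm X // ThetaWF t},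
      thLt s.val t.val → thLt t.val u.val → thLt s.val u.val) ∧
    (∀ s t : {t : ThetaTerm X // ThetaWF t}, s ≠ t → thLt s.val t.val ∨ thLt t.val s.val) := by
  refine ⟨fun s => ThetaTerm.thLt_irrefl _ s.2,
    fun s t u => ThetaTerm.thLt_trans _ _ _ s.2 t.2 u.2, fun s t hne => ?_⟩
  rcases ThetaTerm.thLt_trichotomy _ _ s.2 t.2 with h | h | h
  · exact .inl h
  · exact absurd (Subtype.ext h) hne
  · exact .inr h
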